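/- arXiv:1902.08419 — 4 statements merged into one kernel-verified Lean document; each statement's English description precedes it below -/
import Mathlib

section
/- Main soundness theorem (reduction of total correctness to partial correctness), abstract relational form: Suppose there exists a bound function s : C → ℕ such that R' satisfies partial correctness for the pair (P', Q'), where P' (γ, n) holds iff P γ holds and n = s γ, and Q' (γ, m) holds iff Q γ holds. Then R totally satisfies (P, Q), i.e., every R-execution starting from a configuration γ with P γ that is either complete or infinite contains a configuration γ' with Q γ'. -/
/-- `p 0, p 1, …, p k` is an `R`-path of length `k` (`R`-steps at every consecutive pair). -/
def IsRelPath {C : Type*} (R : C → C → Prop) (p : ℕ → C) (k : ℕ) : Prop :=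
  ∀ i < k, R (p i) (p (i + 1))

/-- The path `p 0, …, p k` is complete: its last element has no `R`-successor. -/
def IsCompletePath {C : Type*} (R : C → C → Prop) (p : ℕ → C) (k : ℕ) : Prop :=
  ¬ ∃ δ, R (p k) δ

/-- `R` satisfies partial correctness for `(P, Q)`: every complete `R`-path starting
from a configuration satisfying `P` contains a configuration satisfying `Q`. -/
def PartialCorrect {C : Type*} (R : C → C → Prop) (P Q : C → Prop) : Prop :=
  ∀ (p : ℕ → C) (k : ℕ), IsRelPath R p k → IsCompletePath R p k → P (p 0) →
    ∃ i ≤ k, Q (p i)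

/-- `R` totally satisfies `(P, Q)`: every `R`-execution (complete finite path or
infinite execution) starting from a configuration satisfying `P` contains a
configuration satisfying `Q`. -/
def TotalCorrect {C : Type*} (R : C → C → Prop) (P Q : C → Prop) : Prop :=
  (∀ (p : ℕ → C) (k : ℕ), IsRelPath R p k → IsCompletePath R p k → P (p 0) →
    ∃ i ≤ k, Q (p i)) ∧
  (∀ p : ℕ → C, (∀ i, R (p i) (p (i + 1))) → P (p 0) → ∃ i, Q (p i))

/-- `γ` terminates in `R`: there is no infinite `R`-execution starting from `γ`. -/
def TerminatesRel {C : Type*} (R : C → C → Prop) (γ : C) : Prop :=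
  ¬ ∃ p : ℕ → C, p 0 = γ ∧ ∀ i, R (p i) (p (i + 1))

/-- The θ-transformed relation on `C × ℕ`:
`R' (γ, n) (γ', m) ↔ R γ γ' ∧ n = m + 1`. -/
def theta {C : Type*} (R : C → C → Prop) : C × ℕ → C × ℕ → Prop :=
  fun a b => R a.1 b.1 ∧ a.2 = b.2 + 1

/-- Main soundness theorem: if some bound function `s` makes the θ-transformed
system partially correct for the transformed pre/postconditions, then the
original system is totally correct for `(P, Q)`. -/
theorem total_of_partial_theta {C : Type*} (R : C → C → Prop) (P Q : C → Prop)
    (h : ∃ s : C → ℕ, PartialCorrect (theta R)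
      (fun x => P x.1 ∧ x.2 = s x.1) (fun x => Q x.1)) :
    TotalCorrect R P Q := by
  obtain ⟨s, hs⟩ := h
  constructor
  · intro p k hp hc hP
    obtain ⟨i, hi, hQ⟩ := hs (fun i => (p i, s (p 0) - i)) (min k (s (p 0)))
      (fun i hi => ⟨hp i (by omega), by simp only; omega⟩)
      (by
        rintro ⟨⟨δ, m⟩, h1, h2⟩
        simp only at h1 h2
        have hk : min k (s (p 0)) = k := by omega
        rw [hk] at h1
        exact hc ⟨δ, h1⟩)
      ⟨hP, by simp⟩
    exact ⟨i, by omega, hQ⟩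
  · intro p hp hP
    obtain ⟨i, hi, hQ⟩ := hs (fun i => (p i, s (p 0) - i)) (s (p 0))
      (fun i hi => ⟨hp i, by simp only; omega⟩)
      (by
        rintro ⟨⟨δ, m⟩, h1, h2⟩
        simp only at h2
        omega)
      ⟨hP, by simp⟩
    exact ⟨i, hQ⟩
end

section
/- Corollary, part 1: Suppose there exists a bound function s : C → ℕ such that R' satisfies partial correctness for the pair (P', Q'), where P' (γ, n) holds iff P γ holds and n = s γ, and Q' (γ, m) holds iff Q γ holds. Then R satisfies partial correctness for (P, Q), i.e., every complete R-path starting from a configuration γ with P γ contains a configuration γ' with Q γ'. -/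
/-- Corollary, part 1: the hypothesis of the main theorem implies
partial correctness of the original system. -/
theorem partial_of_partial_theta {C : Type*} (R : C → C → Prop) (P Q : C → Prop)
    (h : ∃ s : C → ℕ, PartialCorrect (theta R)
      (fun x => P x.1 ∧ x.2 = s x.1) (fun x => Q x.1)) :
    PartialCorrect R P Q := by
  obtain ⟨s, hs⟩ := h
  intro p k hp hc hP
  have h1 : IsRelPath (theta R) (fun i => (p i, s (p 0) - i)) (min k (s (p 0))) := by
    intro i hi
    rw [lt_min_iff] at hi
    refine ⟨hp i hi.1, ?_⟩
    show s (p 0) - i = s (p 0) - (i + 1) + 1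
    omega
  have h2 : IsCompletePath (theta R) (fun i => (p i, s (p 0) - i)) (min k (s (p 0))) := by
    rintro ⟨⟨c, m⟩, hR, hm⟩
    rcases le_total k (s (p 0)) with hk | hk
    · rw [min_eq_left hk] at hR
      exact hc ⟨c, hR⟩
    · rw [min_eq_right hk] at hm
      simp at hm
  obtain ⟨i, hi, hQ⟩ := hs _ _ h1 h2 ⟨hP, Nat.sub_zero _⟩
  exact ⟨i, le_trans hi (min_le_left _ _), hQ⟩
end

section
/- Corollary, part 2: Suppose there exists a bound function s : C → ℕ such that R' satisfies partial correctness for the pair (P', Q'), where P' (γ, n) holds iff P γ holds and n = s γ, and Q' (γ, m) holds iff Q γ holds. If every configuration γ' with Q γ' terminates in R, then every configuration γ with P γ terminates in R. -/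
/-- Corollary, part 2: under the hypothesis of the main theorem, if every
configuration satisfying `Q` terminates in `R`, then every configuration
satisfying `P` terminates in `R`. -/
theorem terminates_of_partial_theta {C : Type*} (R : C → C → Prop) (P Q : C → Prop)
    (h : ∃ s : C → ℕ, PartialCorrect (theta R)
      (fun x => P x.1 ∧ x.2 = s x.1) (fun x => Q x.1))
    (hQ : ∀ γ', Q γ' → TerminatesRel R γ') :
    ∀ γ, P γ → TerminatesRel R γ := by
  rintro γ hP ⟨p, h0, hp⟩
  obtain ⟨s, hs⟩ := h
  obtain ⟨i, -, hi⟩ := hs (fun i => (p i, s γ - i)) (s γ)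
    (fun i hi => ⟨hp i, by dsimp only; omega⟩)
    (by rintro ⟨δ, -, hδ⟩; dsimp only at hδ; omega)
    (by subst h0; exact ⟨hP, rfl⟩)
  exact hQ _ hi ⟨fun j => p (i + j), rfl, fun j => hp (i + j)⟩
end

section
/- Converse for finitely-branching systems (via König's lemma): assume that for every configuration γ the set of R-successors {γ' | R γ γ'} is finite, that R satisfies partial correctness for (P, Q), and that every configuration γ with P γ terminates in R. Then there exists a bound function s : C → ℕ such that R' satisfies partial correctness for the pair (P', Q'), where P' (γ, n) holds iff P γ holds and n = s γ, and Q' (γ, m) holds iff Q γ holds. -/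
/-- Every `R`-path from `γ` has length at most `n`. -/
def PathBound {C : Type*} (R : C → C → Prop) (γ : C) (n : ℕ) : Prop :=
  ∀ (p : ℕ → C) (k : ℕ), IsRelPath R p k → p 0 = γ → k ≤ n

theorem pathBound_of_succ {C : Type*} (R : C → C → Prop) (γ : C)
    (hfin : {γ' | R γ γ'}.Finite) (h : ∀ δ, R γ δ → ∃ n, PathBound R δ n) :
    ∃ n, PathBound R γ n := by
  choose! f hf using h
  obtain ⟨B, hB⟩ := (hfin.image f).bddAbove
  refine ⟨B + 1, fun p k hp h0 => ?_⟩
  cases k with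
  | zero => omega
  | succ k =>
    have h1 : R γ (p 1) := h0 ▸ hp 0 (by omega)
    have h2 : k ≤ f (p 1) :=
      hf (p 1) h1 (fun i => p (i + 1)) k (fun i hi => hp (i + 1) (by omega)) rfl
    have h3 : f (p 1) ≤ B := hB ⟨p 1, h1, rfl⟩
    omega

theorem exists_pathBound {C : Type*} (R : C → C → Prop)
    (hfin : ∀ γ : C, {γ' | R γ γ'}.Finite) (γ : C) (ht : TerminatesRel R γ) :
    ∃ n, PathBound R γ n := by
  by_contra hγ
  have step : ∀ x : {x : C // ¬ ∃ n, PathBound R x n},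
      ∃ y : {x : C // ¬ ∃ n, PathBound R x n}, R x.1 y.1 := by
    rintro ⟨x, hx⟩
    by_contra hc
    refine hx (pathBound_of_succ R x (hfin x) fun δ hδ => ?_)
    by_contra hb
    exact hc ⟨⟨δ, hb⟩, hδ⟩
  choose g hg using step
  refine ht ⟨fun i => (g^[i] ⟨γ, hγ⟩).1, rfl, fun i => ?_⟩
  simp only [Function.iterate_succ_apply']
  exact hg _

/-- Converse for finitely-branching systems (via König's lemma): partial
correctness together with termination of all `P`-configurations yields a
bound function `s` making the θ-transformed system partially correct. -/
theorem partial_theta_of_partial_and_terminating {C : Type*}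
    (R : C → C → Prop) (P Q : C → Prop)
    (hfin : ∀ γ : C, {γ' | R γ γ'}.Finite)
    (hpc : PartialCorrect R P Q)
    (hterm : ∀ γ, P γ → TerminatesRel R γ) :
    ∃ s : C → ℕ, PartialCorrect (theta R)
      (fun x => P x.1 ∧ x.2 = s x.1) (fun x => Q x.1) := by
  classical
  have hb : ∀ γ, P γ → ∃ n, PathBound R γ n :=
    fun γ h => exists_pathBound R hfin γ (hterm γ h)
  choose! s hs using hb
  refine ⟨s, fun p k hp hc h0 => ?_⟩
  obtain ⟨hP, hn⟩ := h0
  refine hpc (fun i => (p i).1) k (fun i hi => (hp i hi).1) ?_ hP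
  rintro ⟨δ, hδ⟩
  have hcount : ∀ i ≤ k, (p i).2 + i = s (p 0).1 := by
    intro i
    induction i with
    | zero => intro _; simpa using hn
    | succ i ih =>
      intro hi
      have h1 := ih (by omega)
      have h2 := (hp i (by omega)).2
      omega
  have hlen : k + 1 ≤ s (p 0).1 := by
    refine hs _ hP (fun i => if i ≤ k then (p i).1 else δ) (k + 1) (fun i hi => ?_) (by simp)
    by_cases hik : i = k
    · subst hik
      simpa using hδ
    · have h1 : i ≤ k := by omega
      have h2 : i + 1 ≤ k := by omega
      simp only [h1, h2, if_true]
      exact (hp i (by omega)).1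
  have hk := hcount k le_rfl
  refine hc ⟨(δ, (p k).2 - 1), hδ, ?_⟩
  show (p k).2 = (p k).2 - 1 + 1
  omega
end
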